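/- Let n ≥ 1 and 1 ≤ r ≤ n be integers and f : {-1,1}^n → ℝ. Then SStab_r[f] = (1/C(n,r)) · Σ_{k=0}^n W_k[f] · K_r^(n)(k), and BStab_r[f] = W_0[f] + (1/C(n,≤r)) · Σ_{k=1}^n W_k[f] · K_r^{(n−1)}(k−1). -/

import Mathlib

open Finset

noncomputable section

/-- The Hamming ball of radius `r` around the all-ones vector in `{-1,1}^n`
(vertices modeled as `Fin n → ℤˣ`, where `ℤˣ = {1, -1}`). -/
def hBall (n r : ℕ) : Finset (Fin n → ℤˣ) :=
  Finset.univ.filter fun z => hammingDist z 1 ≤ r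

/-- The Hamming sphere of radius `r` around the all-ones vector. -/
def hSphere (n r : ℕ) : Finset (Fin n → ℤˣ) :=
  Finset.univ.filter fun z => hammingDist z 1 = r

/-- Ball-noise stability `E[f(X) f(X∘Z)]`, `X` uniform on the cube, `Z` uniform on `B_r`. -/
def BStab (n r : ℕ) (f : (Fin n → ℤˣ) → ℝ) : ℝ :=
  (∑ x : Fin n → ℤˣ, ∑ z ∈ hBall n r, f x * f (x * z)) / (2 ^ n * (hBall n r).card)

/-- Sphere-noise stability `E[f(X) f(X∘Z)]`, `X` uniform on the cube, `Z` uniform on `S_r`. -/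
def SStab (n r : ℕ) (f : (Fin n → ℤˣ) → ℝ) : ℝ :=
  (∑ x : Fin n → ℤˣ, ∑ z ∈ hSphere n r, f x * f (x * z)) / (2 ^ n * (hSphere n r).card)

/-- i.i.d.-noise stability `E[f(X) f(X∘Z)]`, `Z` with i.i.d. coordinates equal to `-1`
with probability `β` and `1` with probability `1-β`. -/
def Stab (n : ℕ) (β : ℝ) (f : (Fin n → ℤˣ) → ℝ) : ℝ :=
  (∑ x : Fin n → ℤˣ, ∑ z : Fin n → ℤˣ,
      (∏ i, if z i = 1 then 1 - β else β) * (f x * f (x * z))) / 2 ^ n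

/-- Indicator function of a set `A` of vertices. -/
def indic (n : ℕ) (A : Finset (Fin n → ℤˣ)) : (Fin n → ℤˣ) → ℝ :=
  fun x => if x ∈ A then 1 else 0

/-- `Γ_B^(n)(M,r)`: maximal ball-noise stability over Boolean functions with exactly `M` ones. -/
def GammaB (n M r : ℕ) : ℝ :=
  sSup {y | ∃ A : Finset (Fin n → ℤˣ), A.card = M ∧ y = BStab n r (indic n A)}

/-- `Γ_S^(n)(M,r)`: maximal sphere-noise stability over Boolean functions with exactly `M` ones. -/
def GammaS (n M r : ℕ) : ℝ :=
  sSup {y | ∃ A : Finset (Fin n → ℤˣ), A.card = M ∧ y = SStab n r (indic n A)}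

/-- `Γ_IID^(n)(M,β)`: maximal i.i.d.-noise stability over Boolean functions with exactly `M` ones. -/
def GammaIID (n M : ℕ) (β : ℝ) : ℝ :=
  sSup {y | ∃ A : Finset (Fin n → ℤˣ), A.card = M ∧ y = Stab n β (indic n A)}

/-- `Γ_IID(α,β) := sup_n Γ_IID^(n)(⌊α·2^n⌋, β)` (equivalently the limit, by monotonicity). -/
def GammaIIDlim (α β : ℝ) : ℝ := ⨆ n : ℕ, GammaIID n ⌊α * 2 ^ n⌋₊ β

/-- `C(n, ≤ r) = Σ_{i=0}^r C(n,i)`. -/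
def ballBinom (n r : ℕ) : ℕ := ∑ i ∈ Finset.range (r + 1), n.choose i

/-- Generalized binomial coefficient `C(x, j) = x(x-1)⋯(x-j+1)/j!` for real `x`. -/
def rchoose (x : ℝ) (j : ℕ) : ℝ := (∏ i ∈ Finset.range j, (x - i)) / (Nat.factorial j)

/-- Krawtchouk polynomial `K_k^(n)(x) = Σ_{j=0}^k (-1)^j C(x,j) C(n-x, k-j)`. -/
def kraw (n k : ℕ) (x : ℝ) : ℝ :=
  ∑ j ∈ Finset.range (k + 1), (-1 : ℝ) ^ j * rchoose x j * rchoose ((n : ℝ) - x) (k - j)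

/-- Fourier coefficient `f̂_S = E[f(X) χ_S(X)]`, where `χ_S(x) = Π_{i ∈ S} x_i`. -/
def fCoeff (n : ℕ) (f : (Fin n → ℤˣ) → ℝ) (S : Finset (Fin n)) : ℝ :=
  (∑ x : Fin n → ℤˣ, f x * ∏ i ∈ S, ((x i : ℤ) : ℝ)) / 2 ^ n

/-- Degree-`k` Fourier weight `W_k[f] = Σ_{|S| = k} f̂_S²`. -/
def fWeight (n : ℕ) (f : (Fin n → ℤˣ) → ℝ) (k : ℕ) : ℝ :=
  ∑ S ∈ Finset.univ.filter (fun S : Finset (Fin n) => S.card = k), (fCoeff n f S) ^ 2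

/-- The Walsh character `χ_S(x) = ∏ i ∈ S, x i`. -/
def walshChar {n : ℕ} (S : Finset (Fin n)) (x : Fin n → ℤˣ) : ℝ :=
  ∏ i ∈ S, ((x i : ℤ) : ℝ)

lemma walshChar_mul {n : ℕ} (S : Finset (Fin n)) (x y : Fin n → ℤˣ) :
    walshChar S (x * y) = walshChar S x * walshChar S y := by
  simp [walshChar, Finset.prod_mul_distrib]

lemma sum_walshChar {n : ℕ} (w : Fin n → ℤˣ) :
    ∑ S : Finset (Fin n), walshChar S w = if w = 1 then 2 ^ n else 0 := by
  have h : ∑ S : Finset (Fin n), walshChar S w = ∏ i, (1 + ((w i : ℤ) : ℝ)) := by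
    simp [walshChar, Finset.prod_one_add]
  rw [h]
  split_ifs with hw
  · subst hw
    norm_num
  · obtain ⟨i, hi⟩ := Function.ne_iff.mp hw
    refine Finset.prod_eq_zero (Finset.mem_univ i) ?_
    rw [(Int.units_eq_one_or (w i)).resolve_left hi]
    norm_num

/-- Fourier expansion of the autocorrelation of `f`. -/
lemma sum_mul_shift_eq {n : ℕ} (f : (Fin n → ℤˣ) → ℝ) (z : Fin n → ℤˣ) :
    ∑ x, f x * f (x * z) = 2 ^ n * ∑ S, fCoeff n f S ^ 2 * walshChar S z := by
  have hS (S : Finset (Fin n)) : fCoeff n f S ^ 2 * walshChar S z =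
      (∑ x, ∑ y, f x * f y * walshChar S (x * z * y)) / (2 ^ n * 2 ^ n) := by
    have : fCoeff n f S = (∑ x, f x * walshChar S x) / 2 ^ n := rfl
    rw [this, div_pow, sq, sq, Finset.sum_mul_sum, div_mul_eq_mul_div, Finset.sum_mul]
    simp_rw [Finset.sum_mul, walshChar_mul]
    congr 1
    exact Finset.sum_congr rfl fun x _ => Finset.sum_congr rfl fun y _ => by ring
  have hx (x y : Fin n → ℤˣ) : x * z * y = 1 ↔ y = x * z := by
    constructor
    · intro h
      rw [eq_inv_of_mul_eq_one_right h]
      ext i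
      simp [mul_comm]
    · rintro rfl
      ext i
      simp
  simp_rw [hS]
  rw [← Finset.sum_div, Finset.sum_comm]
  have key (x : Fin n → ℤˣ) :
      ∑ S, ∑ y, f x * f y * walshChar S (x * z * y) = 2 ^ n * (f x * f (x * z)) := by
    rw [Finset.sum_comm]
    simp_rw [← Finset.mul_sum, sum_walshChar, hx]
    simp [mul_comm]
  simp_rw [key, ← Finset.mul_sum]
  field_simp

open Polynomial in
/-- Character sums over Hamming spheres, as coefficients of their generating function. -/
lemma sum_walshChar_hSphere {n : ℕ} (S : Finset (Fin n)) (r : ℕ) :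
    ∑ z ∈ hSphere n r, walshChar S z =
      ((1 - X) ^ S.card * (1 + X) ^ (n - S.card) : ℝ[X]).coeff r := by
  classical
  have hgen : ∑ z : Fin n → ℤˣ, C (walshChar S z) * X ^ hammingDist z 1 =
      ((1 - X) ^ S.card * (1 + X) ^ (n - S.card) : ℝ[X]) := by
    let g (i : Fin n) (u : ℤˣ) : ℝ[X] :=
      (if i ∈ S then C ((u : ℤ) : ℝ) else 1) * (if u ≠ 1 then X else 1)
    have hg (z : Fin n → ℤˣ) : C (walshChar S z) * X ^ hammingDist z 1 = ∏ i, g i (z i) := by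
      simp only [g, Finset.prod_mul_distrib, walshChar, hammingDist, map_prod]
      congr 1
      · simp [Finset.prod_ite_mem]
      · rw [← Finset.prod_filter, Finset.prod_const]
        simp
    have hsum (i : Fin n) : ∑ u, g i u = if i ∈ S then 1 - X else 1 + X := by
      have hu : (Finset.univ : Finset ℤˣ) = {1, -1} := rfl
      rw [hu, Finset.sum_pair (by decide)]
      split_ifs with hi <;> simp [g, hi, sub_eq_add_neg]
    simp_rw [hg]
    rw [← Fintype.piFinset_univ, ← Finset.prod_univ_sum]
    simp_rw [hsum]
    rw [Finset.prod_ite, Finset.prod_const, Finset.prod_const]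
    congr 2
    · simp
    · rw [Finset.filter_not, Finset.card_sdiff]
      simp
  rw [← hgen, finsetSum_coeff, hSphere, Finset.sum_filter]
  refine Finset.sum_congr rfl fun z _ => ?_
  rw [coeff_C_mul, coeff_X_pow]
  simp [eq_comm]

lemma rchoose_natCast (m j : ℕ) : rchoose m j = m.choose j := by
  rw [rchoose, Nat.cast_choose_eq_descPochhammer_div, descPochhammer_eval_eq_prod_range]

open Polynomial in
/-- Krawtchouk polynomials at natural numbers, as coefficients of `(1 - X)^a (1 + X)^b`. -/
lemma kraw_natCast (a b m r : ℕ) (hm : m = a + b) :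
    kraw m r a = ((1 - X) ^ a * (1 + X) ^ b : ℝ[X]).coeff r := by
  have hneg (j : ℕ) : ((1 - X) ^ a : ℝ[X]).coeff j = (-1) ^ j * a.choose j := by
    have : ((1 - X) ^ a : ℝ[X]) = ((1 + X) ^ a : ℝ[X]).comp (C (-1) * X) := by
      simp [sub_eq_add_neg]
    rw [this, comp_C_mul_X_coeff, coeff_one_add_X_pow, mul_comm]
  rw [coeff_mul, Finset.Nat.sum_antidiagonal_eq_sum_range_succ_mk, kraw]
  refine Finset.sum_congr rfl fun j _ => ?_
  have hb : (m : ℝ) - a = (b : ℕ) := by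
    rw [hm]
    push_cast
    ring
  rw [hb, rchoose_natCast, rchoose_natCast, hneg, coeff_one_add_X_pow]

open Polynomial in
lemma sum_range_coeff_one_sub_X_mul (q : ℝ[X]) (r : ℕ) :
    ∑ j ∈ Finset.range (r + 1), ((1 - X) * q).coeff j = q.coeff r := by
  induction r with
  | zero => simp [sub_mul]
  | succ r ih =>
    rw [Finset.sum_range_succ, ih, sub_mul, one_mul, coeff_sub, coeff_X_mul]
    ring

lemma sum_hBall {n : ℕ} (r : ℕ) (g : (Fin n → ℤˣ) → ℝ) :
    ∑ z ∈ hBall n r, g z = ∑ j ∈ Finset.range (r + 1), ∑ z ∈ hSphere n j, g z := by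
  rw [← Finset.sum_fiberwise_of_maps_to (t := Finset.range (r + 1))
    (g := fun z => hammingDist z 1) (by simp [hBall])]
  refine Finset.sum_congr rfl fun j hj => Finset.sum_congr ?_ fun _ _ => rfl
  ext z
  simp only [hBall, hSphere, Finset.mem_filter, Finset.mem_univ, true_and, Finset.mem_range] at *
  omega

lemma card_hSphere (n r : ℕ) : ((hSphere n r).card : ℝ) = n.choose r := by
  have h := sum_walshChar_hSphere (∅ : Finset (Fin n)) r
  simpa [walshChar, Polynomial.coeff_one_add_X_pow] using h

lemma card_hBall (n r : ℕ) : ((hBall n r).card : ℝ) = ballBinom n r := by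
  have h := sum_hBall (n := n) r fun _ => 1
  simpa [card_hSphere, ballBinom] using h

lemma sum_walshChar_hSphere_eq_kraw {n : ℕ} (S : Finset (Fin n)) (r : ℕ) :
    ∑ z ∈ hSphere n r, walshChar S z = kraw n r S.card := by
  have hS : S.card ≤ n := by simpa using S.card_le_univ
  rw [sum_walshChar_hSphere, kraw_natCast _ (n - S.card) _ _ (by omega)]

lemma sum_walshChar_hBall_eq_kraw {n : ℕ} (S : Finset (Fin n)) (hS0 : 1 ≤ S.card) (r : ℕ) :
    ∑ z ∈ hBall n r, walshChar S z = kraw (n - 1) r ((S.card : ℝ) - 1) := by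
  have hS : S.card ≤ n := by simpa using S.card_le_univ
  obtain ⟨k, hk⟩ : ∃ k, S.card = k + 1 := ⟨S.card - 1, by omega⟩
  have hcast : (S.card : ℝ) - 1 = (k : ℕ) := by
    rw [hk]
    push_cast
    ring
  simp_rw [sum_hBall, sum_walshChar_hSphere]
  rw [hcast, kraw_natCast _ (n - S.card) _ _ (by omega), hk]
  simp_rw [pow_succ', mul_assoc]
  exact sum_range_coeff_one_sub_X_mul _ _

/-- Correlation with noise uniform on `A`, expanded over characters. -/
lemma stability_eq {n : ℕ} (f : (Fin n → ℤˣ) → ℝ) (A : Finset (Fin n → ℤˣ)) :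
    (∑ x, ∑ z ∈ A, f x * f (x * z)) / (2 ^ n * A.card) =
      1 / (A.card : ℝ) * ∑ S, fCoeff n f S ^ 2 * ∑ z ∈ A, walshChar S z := by
  rw [Finset.sum_comm]
  simp_rw [sum_mul_shift_eq, ← Finset.mul_sum]
  rw [Finset.sum_comm, mul_div_mul_left _ _ (by positivity), div_eq_mul_one_div, mul_comm]
  simp_rw [Finset.mul_sum]

lemma sum_fWeight_mul {n : ℕ} (f : (Fin n → ℤˣ) → ℝ) (c : ℕ → ℝ) :
    ∑ k ∈ Finset.range (n + 1), fWeight n f k * c k = ∑ S, fCoeff n f S ^ 2 * c S.card := by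
  have hmaps : ∀ S ∈ (Finset.univ : Finset (Finset (Fin n))), S.card ∈ Finset.range (n + 1) :=
    fun S _ => Finset.mem_range_succ_iff.mpr (by simpa using S.card_le_univ)
  rw [← Finset.sum_fiberwise_of_maps_to hmaps]
  refine Finset.sum_congr rfl fun k _ => ?_
  rw [fWeight, Finset.sum_mul]
  refine Finset.sum_congr rfl fun S hS => ?_
  rw [(Finset.mem_filter.mp hS).2]

/-- Fourier-analytic expressions of the sphere-noise and ball-noise
stabilities in terms of Fourier weights and Krawtchouk polynomials. -/
theorem stab_fourier_expansion (n r : ℕ) (hn : 1 ≤ n) (hr1 : 1 ≤ r) (hrn : r ≤ n)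
    (f : (Fin n → ℤˣ) → ℝ) :
    SStab n r f =
        (1 / (n.choose r : ℝ)) * ∑ k ∈ Finset.range (n + 1), fWeight n f k * kraw n r (k : ℝ) ∧
    BStab n r f =
        fWeight n f 0 +
          (1 / (ballBinom n r : ℝ)) *
            ∑ k ∈ Finset.Icc 1 n, fWeight n f k * kraw (n - 1) r ((k : ℝ) - 1) := by
  constructor
  · rw [SStab, stability_eq, card_hSphere, sum_fWeight_mul f fun k => kraw n r k]
    simp_rw [sum_walshChar_hSphere_eq_kraw]
  · let c (k : ℕ) : ℝ := if k = 0 then ballBinom n r else kraw (n - 1) r ((k : ℝ) - 1)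
    have hc (S : Finset (Fin n)) : ∑ z ∈ hBall n r, walshChar S z = c S.card := by
      rcases S.eq_empty_or_nonempty with rfl | hS
      · simp [c, walshChar, card_hBall]
      · rw [sum_walshChar_hBall_eq_kraw S hS.card_pos]
        simp [c, hS.ne_empty]
    have hball : (ballBinom n r : ℝ) ≠ 0 := by
      rw [ballBinom, Finset.sum_range_succ']
      simp only [Nat.choose_zero_right]
      positivity
    rw [BStab, stability_eq, card_hBall]
    simp_rw [hc]
    rw [← sum_fWeight_mul, Finset.range_eq_Ico, Finset.sum_eq_sum_Ico_succ_bot (Nat.succ_pos n),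
      mul_add]
    congr 1
    · simp only [c, if_true]
      field_simp
    · congr 1
      refine Finset.sum_congr rfl fun k hk => ?_
      have hk0 : k ≠ 0 := by
        have := Finset.mem_Ico.mp hk
        omega
      simp [c, hk0]
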